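/- Under the hypotheses of the mixture bound—positive row-stochastic T_{b_1},…,T_{b_K}, T_φ ∈ ℝ^{N×N} with stationary distributions d_{b_1},…,d_{b_K}, d_φ, uniform weights w_k = 1/K so that d_b = (1/K)Σ_{k=1}^K d_{b_k}, constants κ_{max,k} and κ_max = max_k κ_{max,k} defined as before, and max_k ‖T_{b_k} − T_φ‖_∞ ≤ ε < 1/κ_max—one has ‖d_φ − d_b‖₁ ≤ (1/K) Σ_{k=1}^K ε·κ_{max,k}/(1 − ε·κ_{max,k}). -/

import Mathlib

open Matrix BigOperators

/-- The ℓ¹ norm of a vector: sum of the absolute values of its entries. -/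
noncomputable def l1Norm {N : ℕ} (v : Fin N → ℝ) : ℝ := ∑ i, |v i|

/-- The operator norm induced by the ℓ¹ vector norm: maximum absolute column sum. -/
noncomputable def opNorm {N : ℕ} (M : Matrix (Fin N) (Fin N) ℝ) : ℝ :=
  ⨆ j, ∑ i, |M i j|

/-- The `‖·‖_∞` matrix norm: maximum absolute row sum. -/
noncomputable def rowNorm {N : ℕ} (M : Matrix (Fin N) (Fin N) ℝ) : ℝ :=
  ⨆ i, ∑ j, |M i j|

/-- The condition number `κ(M) = ‖M‖₁·‖M⁻¹‖₁` with respect to the ℓ¹-induced operator norm. -/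
noncomputable def condNum {N : ℕ} (M : Matrix (Fin N) (Fin N) ℝ) : ℝ :=
  opNorm M * opNorm M⁻¹

/-- The `(N+1) × N` matrix whose first row is the all-ones row vector and whose
remaining `N` rows form `I − Tᵀ`. -/
def hatMat {N : ℕ} (T : Matrix (Fin N) (Fin N) ℝ) : Matrix (Fin (N + 1)) (Fin N) ℝ :=
  Matrix.of (Fin.cons (fun _ => (1 : ℝ))
    (fun i j => ((1 : Matrix (Fin N) (Fin N) ℝ) - Tᵀ) i j))

/-- Delete row `i` from an `(N+1) × N` matrix, yielding an `N × N` matrix. -/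
def delRow {N : ℕ} (M : Matrix (Fin (N + 1)) (Fin N) ℝ) (i : Fin (N + 1)) :
    Matrix (Fin N) (Fin N) ℝ :=
  M.submatrix i.succAbove id

/-- `κ_max` for a row-stochastic matrix `T`: the maximum, over indices `i ∈ {2,…,N+1}`
(i.e. `i ≠ 0` in `Fin (N+1)`) such that deleting row `i` of `hatMat T` yields an invertible
`N×N` matrix, of the condition number of that matrix. -/
noncomputable def kappaMax {N : ℕ} (T : Matrix (Fin N) (Fin N) ℝ) : ℝ :=
  sSup {c : ℝ | ∃ i : Fin (N + 1), i ≠ 0 ∧ IsUnit (delRow (hatMat T) i).det ∧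
    c = condNum (delRow (hatMat T) i)}

theorem hatMat_mulVec_zero {N : ℕ} (T : Matrix (Fin N) (Fin N) ℝ) (x : Fin N → ℝ) :
    (hatMat T *ᵥ x) 0 = ∑ j, x j := by
  simp [hatMat, Matrix.mulVec, dotProduct]

theorem hatMat_mulVec_succ {N : ℕ} (T : Matrix (Fin N) (Fin N) ℝ) (x : Fin N → ℝ) (j : Fin N) :
    (hatMat T *ᵥ x) j.succ = x j - (x ᵥ* T) j := by
  have h : (hatMat T *ᵥ x) j.succ = (((1 : Matrix (Fin N) (Fin N) ℝ) - Tᵀ) *ᵥ x) j := by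
    simp [hatMat, Matrix.mulVec, dotProduct]
  rw [h, Matrix.sub_mulVec, Matrix.one_mulVec, Matrix.mulVec_transpose, Pi.sub_apply]

theorem sum_vecMul_of_row_sum {N : ℕ} {T : Matrix (Fin N) (Fin N) ℝ}
    (hT : ∀ i, ∑ j, T i j = 1) (x : Fin N → ℝ) : ∑ j, (x ᵥ* T) j = ∑ j, x j := by
  simp only [Matrix.vecMul, dotProduct]
  rw [Finset.sum_comm]
  simp [← Finset.mul_sum, hT]

theorem l1Norm_nonneg {N : ℕ} (v : Fin N → ℝ) : 0 ≤ l1Norm v :=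
  Finset.sum_nonneg fun _ _ => abs_nonneg _

theorem opNorm_nonneg {N : ℕ} (M : Matrix (Fin N) (Fin N) ℝ) : 0 ≤ opNorm M :=
  Real.iSup_nonneg fun _ => Finset.sum_nonneg fun _ _ => abs_nonneg _

theorem rowNorm_nonneg {N : ℕ} (M : Matrix (Fin N) (Fin N) ℝ) : 0 ≤ rowNorm M :=
  Real.iSup_nonneg fun _ => Finset.sum_nonneg fun _ _ => abs_nonneg _

theorem col_sum_le_opNorm {N : ℕ} (M : Matrix (Fin N) (Fin N) ℝ) (j : Fin N) :
    ∑ i, |M i j| ≤ opNorm M :=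
  le_ciSup (f := fun j => ∑ i, |M i j|) (Set.finite_range _).bddAbove j

theorem rowNorm_eq_opNorm_transpose {N : ℕ} (M : Matrix (Fin N) (Fin N) ℝ) :
    rowNorm M = opNorm Mᵀ := rfl

theorem l1Norm_mulVec_le {N : ℕ} (M : Matrix (Fin N) (Fin N) ℝ) (x : Fin N → ℝ) :
    l1Norm (M *ᵥ x) ≤ opNorm M * l1Norm x := by
  calc l1Norm (M *ᵥ x) ≤ ∑ i, ∑ j, |M i j| * |x j| := by
        unfold l1Norm
        gcongr with i
        simp only [← abs_mul]
        exact Finset.abs_sum_le_sum_abs (fun j => M i j * x j) Finset.univ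
    _ = ∑ j, (∑ i, |M i j|) * |x j| := by
        rw [Finset.sum_comm]
        simp only [Finset.sum_mul]
    _ ≤ ∑ j, opNorm M * |x j| := by
        gcongr with j
        exact col_sum_le_opNorm M j
    _ = opNorm M * l1Norm x := by rw [l1Norm, Finset.mul_sum]

theorem l1Norm_vecMul_le {N : ℕ} (M : Matrix (Fin N) (Fin N) ℝ) (x : Fin N → ℝ) :
    l1Norm (x ᵥ* M) ≤ rowNorm M * l1Norm x := by
  rw [rowNorm_eq_opNorm_transpose, ← Matrix.mulVec_transpose]
  exact l1Norm_mulVec_le _ _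

/-- A positive row-stochastic matrix has no nonzero fixed row vector of total mass zero. -/
theorem eq_zero_of_vecMul_eq_self_of_sum_eq_zero {N : ℕ} {T : Matrix (Fin N) (Fin N) ℝ}
    (hpos : ∀ i j, 0 < T i j) (hrow : ∀ i, ∑ j, T i j = 1) {x : Fin N → ℝ}
    (hfix : x ᵥ* T = x) (hsum : ∑ i, x i = 0) : x = 0 := by
  obtain rfl | hN := N.eq_zero_or_pos
  · exact Subsingleton.elim _ _
  have : Nonempty (Fin N) := ⟨⟨0, hN⟩⟩
  obtain ⟨p, hp⟩ := Finite.exists_min fun p : Fin N × Fin N => T p.1 p.2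
  set δ := T p.1 p.2
  have hδ : 0 < δ := hpos _ _
  have hle : l1Norm x ≤ (1 - N * δ) * l1Norm x := by
    calc l1Norm x = ∑ j, |∑ i, x i * (T i j - δ)| := by
          refine Finset.sum_congr rfl fun j _ => ?_
          conv_lhs => rw [← hfix]
          simp [Matrix.vecMul, dotProduct, mul_sub, ← Finset.sum_mul, hsum]
      _ ≤ ∑ j, ∑ i, |x i| * (T i j - δ) := by
          refine Finset.sum_le_sum fun j _ => (Finset.abs_sum_le_sum_abs _ _).trans_eq ?_
          refine Finset.sum_congr rfl fun i _ => ?_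
          rw [abs_mul, abs_of_nonneg (sub_nonneg.2 (hp (i, j)))]
      _ = (1 - N * δ) * l1Norm x := by
          rw [Finset.sum_comm, l1Norm, Finset.mul_sum]
          refine Finset.sum_congr rfl fun i _ => ?_
          rw [← Finset.mul_sum, Finset.sum_sub_distrib, hrow]
          simp [mul_comm]
  have hNδ : 0 < N * δ := by positivity
  have hzero : l1Norm x = 0 := by
    nlinarith [l1Norm_nonneg x, mul_nonneg hNδ.le (l1Norm_nonneg x)]
  funext i
  have hterm := (Finset.sum_eq_zero_iff_of_nonneg fun i _ => abs_nonneg (x i)).1 hzero i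
    (Finset.mem_univ i)
  simpa using hterm

theorem isUnit_det_delRow_hatMat {N : ℕ} {T : Matrix (Fin N) (Fin N) ℝ}
    (hpos : ∀ i j, 0 < T i j) (hrow : ∀ i, ∑ j, T i j = 1) {i : Fin (N + 1)} (hi : i ≠ 0) :
    IsUnit (delRow (hatMat T) i).det := by
  rw [isUnit_iff_ne_zero]
  intro hdet
  obtain ⟨x, hx, hMx⟩ := Matrix.exists_mulVec_eq_zero_iff.2 hdet
  have hdel : ∀ j, (hatMat T *ᵥ x) (i.succAbove j) = 0 := fun j => congrFun hMx j
  have hzero : (hatMat T *ᵥ x) 0 = 0 := by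
    obtain ⟨j, hj⟩ := Fin.exists_succAbove_eq hi.symm
    rw [← hj, hdel]
  have htotal : ∑ a, (hatMat T *ᵥ x) a = 0 := by
    rw [Fin.sum_univ_succ, hzero]
    simp [hatMat_mulVec_succ, sum_vecMul_of_row_sum hrow]
  have hdeleted : (hatMat T *ᵥ x) i = 0 := by
    rw [Fin.sum_univ_succAbove _ i] at htotal
    simpa [hdel] using htotal
  have hall : ∀ a, (hatMat T *ᵥ x) a = 0 := by
    intro a
    by_cases ha : a = i
    · rw [ha, hdeleted]
    · obtain ⟨j, rfl⟩ := Fin.exists_succAbove_eq ha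
      exact hdel j
  refine hx (eq_zero_of_vecMul_eq_self_of_sum_eq_zero hpos hrow ?_ ?_)
  · funext j
    have := hall j.succ
    rw [hatMat_mulVec_succ] at this
    linarith
  · rw [← hatMat_mulVec_zero T, hzero]

theorem one_le_opNorm_delRow_hatMat {N : ℕ} (hN : 0 < N) (T : Matrix (Fin N) (Fin N) ℝ)
    {i : Fin (N + 1)} (hi : i ≠ 0) : 1 ≤ opNorm (delRow (hatMat T) i) := by
  obtain ⟨j, hj⟩ := Fin.exists_succAbove_eq hi.symm
  refine le_trans ?_ (col_sum_le_opNorm _ ⟨0, hN⟩)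
  have hone : |delRow (hatMat T) i j ⟨0, hN⟩| = 1 := by simp [delRow, hj, hatMat]
  rw [← hone]
  exact Finset.single_le_sum (f := fun a => |delRow (hatMat T) i a ⟨0, hN⟩|)
    (fun _ _ => abs_nonneg _) (Finset.mem_univ j)

theorem condNum_le_kappaMax {N : ℕ} (T : Matrix (Fin N) (Fin N) ℝ) {i : Fin (N + 1)}
    (hi : i ≠ 0) (hdet : IsUnit (delRow (hatMat T) i).det) :
    condNum (delRow (hatMat T) i) ≤ kappaMax T := by
  refine le_csSup (Set.Finite.bddAbove ?_) ⟨i, hi, hdet, rfl⟩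
  refine (Set.finite_range fun i => condNum (delRow (hatMat T) i)).subset ?_
  rintro c ⟨i, -, -, rfl⟩
  exact ⟨i, rfl⟩

theorem kappaMax_nonneg {N : ℕ} (T : Matrix (Fin N) (Fin N) ℝ) : 0 ≤ kappaMax T := by
  refine Real.sSup_nonneg ?_
  rintro c ⟨i, -, -, rfl⟩
  exact mul_nonneg (opNorm_nonneg _) (opNorm_nonneg _)

/-- Perturbation bound for the stationary distribution of a positive row-stochastic matrix. -/
theorem l1Norm_stationary_sub_le {N : ℕ} {T S : Matrix (Fin N) (Fin N) ℝ}
    (hpos : ∀ i j, 0 < T i j) (hrow : ∀ i, ∑ j, T i j = 1) {d e : Fin N → ℝ}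
    (hd_sum : ∑ i, d i = 1) (hd : d ᵥ* T = d)
    (he_nonneg : ∀ i, 0 ≤ e i) (he_sum : ∑ i, e i = 1) (he : e ᵥ* S = e) :
    l1Norm (e - d) ≤ rowNorm (T - S) * kappaMax T := by
  have hN : 0 < N := by
    rcases N.eq_zero_or_pos with rfl | h
    · simp at hd_sum
    · exact h
  have hi : Fin.last N ≠ 0 := fun h => hN.ne' (congrArg Fin.val h)
  have hdet := isUnit_det_delRow_hatMat hpos hrow hi
  set M := delRow (hatMat T) (Fin.last N)
  have he_norm : l1Norm e = 1 := by
    simp only [l1Norm, abs_of_nonneg (he_nonneg _), he_sum]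
  have hfull : ∑ a, |(hatMat T *ᵥ (e - d)) a| ≤ rowNorm (T - S) := by
    rw [Fin.sum_univ_succ, hatMat_mulVec_zero]
    have hsucc : ∀ j : Fin N,
        |(hatMat T *ᵥ (e - d)) j.succ| = |(e ᵥ* (T - S)) j| := by
      intro j
      rw [hatMat_mulVec_succ, Matrix.sub_vecMul, Matrix.vecMul_sub, hd, he, ← abs_neg]
      congr 1
      simp only [Pi.sub_apply]
      ring
    simp only [hsucc, Pi.sub_apply, Finset.sum_sub_distrib, he_sum, hd_sum, sub_self, abs_zero,
      zero_add]
    have h := l1Norm_vecMul_le (T - S) e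
    rwa [he_norm, mul_one] at h
  have hres : l1Norm (M *ᵥ (e - d)) ≤ rowNorm (T - S) := by
    refine le_trans ?_ hfull
    rw [Fin.sum_univ_succAbove _ (Fin.last N)]
    exact le_add_of_nonneg_left (abs_nonneg _)
  have hinv : M⁻¹ *ᵥ (M *ᵥ (e - d)) = e - d := by
    rw [Matrix.mulVec_mulVec, Matrix.nonsing_inv_mul _ hdet, Matrix.one_mulVec]
  calc l1Norm (e - d) = l1Norm (M⁻¹ *ᵥ (M *ᵥ (e - d))) := by rw [hinv]
    _ ≤ opNorm M⁻¹ * l1Norm (M *ᵥ (e - d)) := l1Norm_mulVec_le _ _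
    _ ≤ opNorm M⁻¹ * rowNorm (T - S) := mul_le_mul_of_nonneg_left hres (opNorm_nonneg _)
    _ = rowNorm (T - S) * opNorm M⁻¹ := mul_comm _ _
    _ ≤ rowNorm (T - S) * condNum M := by
        refine mul_le_mul_of_nonneg_left ?_ (rowNorm_nonneg _)
        exact le_mul_of_one_le_left (opNorm_nonneg _) (one_le_opNorm_delRow_hatMat hN T hi)
    _ ≤ rowNorm (T - S) * kappaMax T :=
        mul_le_mul_of_nonneg_left (condNum_le_kappaMax T hi hdet) (rowNorm_nonneg _)

/-- The `ℓ¹` distance to a uniform mixture is at most the average distance to its components. -/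
theorem l1Norm_sub_uniform_mixture_le {N K : ℕ} (hK : 0 < K) (e : Fin N → ℝ)
    (d : Fin K → Fin N → ℝ) :
    l1Norm (e - (1 / (K : ℝ)) • ∑ k, d k) ≤ (1 / (K : ℝ)) * ∑ k, l1Norm (e - d k) := by
  have hK' : (K : ℝ) ≠ 0 := by positivity
  calc l1Norm (e - (1 / (K : ℝ)) • ∑ k, d k)
      = ∑ i, (1 / (K : ℝ)) * |∑ k, (e i - d k i)| := by
        refine Finset.sum_congr rfl fun i _ => ?_
        have hcoord : (e - (1 / (K : ℝ)) • ∑ k, d k) i = (1 / (K : ℝ)) * ∑ k, (e i - d k i) := by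
          simp [Finset.sum_sub_distrib]
          field_simp
        rw [hcoord, abs_mul, abs_of_nonneg (by positivity : (0 : ℝ) ≤ 1 / K)]
    _ ≤ ∑ i, (1 / (K : ℝ)) * ∑ k, |e i - d k i| := by
        gcongr
        exact Finset.abs_sum_le_sum_abs _ _
    _ = (1 / (K : ℝ)) * ∑ k, l1Norm (e - d k) := by
        rw [← Finset.mul_sum, Finset.sum_comm]
        rfl

/-- Uniform-mixture perturbation bound: with positive row-stochastic `T_{b_k}` and `T_φ`
having stationary distributions `d_{b_k}` and `d_φ`, uniform weights `w_k = 1/K` so that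
`d_b = (1/K)·Σ_k d_{b_k}`, `max_k ‖T_{b_k} − T_φ‖_∞ ≤ ε`, and `ε < 1/κ_max`, one has
`‖d_φ − d_b‖₁ ≤ (1/K)·Σ_k ε·κ_{max,k}/(1 − ε·κ_{max,k})`. -/
theorem stationary_distribution_perturbation_uniform_mixture {N K : ℕ} (hK : 0 < K)
    (Tb : Fin K → Matrix (Fin N) (Fin N) ℝ) (Tφ : Matrix (Fin N) (Fin N) ℝ)
    (hTb_pos : ∀ k i j, 0 < Tb k i j) (hTb_row : ∀ k i, ∑ j, Tb k i j = 1)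
    (hTφ_pos : ∀ i j, 0 < Tφ i j) (hTφ_row : ∀ i, ∑ j, Tφ i j = 1)
    (db : Fin K → Fin N → ℝ) (dφ : Fin N → ℝ)
    (hdb_nonneg : ∀ k i, 0 ≤ db k i) (hdb_sum : ∀ k, ∑ i, db k i = 1)
    (hdb_stat : ∀ k, Matrix.vecMul (db k) (Tb k) = db k)
    (hdφ_nonneg : ∀ i, 0 ≤ dφ i) (hdφ_sum : ∑ i, dφ i = 1)
    (hdφ_stat : Matrix.vecMul dφ Tφ = dφ)
    (dbMix : Fin N → ℝ) (hdbMix : dbMix = (1 / (K : ℝ)) • ∑ k, db k)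
    (ε : ℝ) (hε : ∀ k, rowNorm (Tb k - Tφ) ≤ ε)
    (hεκ : ε < 1 / (⨆ k, kappaMax (Tb k))) :
    l1Norm (dφ - dbMix)
      ≤ (1 / (K : ℝ)) * ∑ k, ε * kappaMax (Tb k) / (1 - ε * kappaMax (Tb k)) := by
  subst hdbMix
  refine (l1Norm_sub_uniform_mixture_le hK dφ db).trans ?_
  gcongr with k
  have hκ := kappaMax_nonneg (Tb k)
  have hε0 : 0 ≤ ε := (rowNorm_nonneg _).trans (hε k)
  have hbound : l1Norm (dφ - db k) ≤ ε * kappaMax (Tb k) :=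
    (l1Norm_stationary_sub_le (hTb_pos k) (hTb_row k) (hdb_sum k) (hdb_stat k)
      hdφ_nonneg hdφ_sum hdφ_stat).trans (mul_le_mul_of_nonneg_right (hε k) hκ)
  have hle : kappaMax (Tb k) ≤ ⨆ k, kappaMax (Tb k) :=
    le_ciSup (f := fun k => kappaMax (Tb k)) (Set.finite_range _).bddAbove k
  have hsup : 0 < ⨆ k, kappaMax (Tb k) := one_div_pos.1 (hε0.trans_lt hεκ)
  have hlt : ε * kappaMax (Tb k) < 1 :=
    (mul_le_mul_of_nonneg_left hle hε0).trans_lt ((lt_div_iff₀ hsup).1 hεκ)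
  have hprod := mul_nonneg hε0 hκ
  exact hbound.trans (le_div_self hprod (by linarith) (by linarith))
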